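/- arXiv:2504.12603 — 4 statements merged into one kernel-verified Lean document; each statement's English description precedes it below -/
import Mathlib

section
/- If B ⊆ ℝ × ℝ intersects every line of ℝ² in a set of cardinality 𝔠, then B contains a Mazurkiewicz set, i.e., there exists a Mazurkiewicz set M with M ⊆ B. -/
open Cardinal Set

noncomputable section

/-- The line through `p` with direction `v`. -/
def lineThrough (p v : ℝ × ℝ) : Set (ℝ × ℝ) := {q | ∃ t : ℝ, q = p + t • v}

/-- `L` is a straight line of `ℝ²`. -/
def IsLine (L : Set (ℝ × ℝ)) : Prop := ∃ p v : ℝ × ℝ, v ≠ 0 ∧ L = lineThrough p v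

/-- `L` is a vertical line of `ℝ²`. -/
def IsVerticalLine (L : Set (ℝ × ℝ)) : Prop := ∃ x : ℝ, L = {p : ℝ × ℝ | p.1 = x}

/-- `L₁` and `L₂` are parallel lines. -/
def ParallelLines (L₁ L₂ : Set (ℝ × ℝ)) : Prop :=
  ∃ (p₁ p₂ v : ℝ × ℝ) (c : ℝ), v ≠ 0 ∧ c ≠ 0 ∧
    L₁ = lineThrough p₁ v ∧ L₂ = lineThrough p₂ (c • v)

/-- A Mazurkiewicz set meets every line in exactly two points. -/
def IsMazurkiewicz (M : Set (ℝ × ℝ)) : Prop :=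
  ∀ L : Set (ℝ × ℝ), IsLine L → (M ∩ L).encard = 2

/-- The graph of a partial function `g` defined on `S ⊆ ℝ`. -/
def graphOn (S : Set ℝ) (g : S → ℝ) : Set (ℝ × ℝ) := {p | ∃ x : S, p = ((x : ℝ), g x)}

/-- The graph of a function `f : ℝ → ℝ`. -/
def graphOf (f : ℝ → ℝ) : Set (ℝ × ℝ) := {p | ∃ x : ℝ, p = (x, f x)}

/-- A Sierpiński–Zygmund set. -/
def IsSZSet (X : Set (ℝ × ℝ)) : Prop :=
  ∀ (S : Set ℝ) (g : S → ℝ), Continuous g →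
    #↥(X ∩ graphOn S g) < Cardinal.continuum

/-- A Sierpiński–Zygmund function. -/
def IsSZFun (f : ℝ → ℝ) : Prop :=
  ∀ (S : Set ℝ) (g : S → ℝ), Continuous g →
    #↥{x : S | f x.1 = g x} < Cardinal.continuum

/-- Rotation about the origin by angle `θ`. -/
def rot (θ : ℝ) (p : ℝ × ℝ) : ℝ × ℝ :=
  (p.1 * Real.cos θ - p.2 * Real.sin θ, p.1 * Real.sin θ + p.2 * Real.cos θ)

/-- A Hamel basis of `ℝ²`: a basis of `ℝ × ℝ` as a vector space over `ℚ`. -/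
def IsHamelBasis (H : Set (ℝ × ℝ)) : Prop :=
  LinearIndependent ℚ ((↑) : H → ℝ × ℝ) ∧ Submodule.span ℚ H = ⊤

/-- A Hamel function: a function whose graph is a Hamel basis of `ℝ²`. -/
def IsHamelFun (h : ℝ → ℝ) : Prop := IsHamelBasis (graphOf h)

/-- Every line meets `M` in at most two points. -/
def NoThreeCollinear (M : Set (ℝ × ℝ)) : Prop :=
  ∀ L, IsLine L → ∀ a ∈ M ∩ L, ∀ b ∈ M ∩ L, ∀ c ∈ M ∩ L, a = b ∨ a = c ∨ b = c

theorem IsLine.eq_lineThrough {L : Set (ℝ × ℝ)} (hL : IsLine L) {a b : ℝ × ℝ}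
    (ha : a ∈ L) (hb : b ∈ L) (hab : a ≠ b) : L = lineThrough a (b - a) := by
  obtain ⟨p, v, -, rfl⟩ := hL
  obtain ⟨s, rfl⟩ := ha
  obtain ⟨t, rfl⟩ := hb
  have hst : t - s ≠ 0 := fun h => hab (by rw [sub_eq_zero.mp h])
  ext q
  constructor
  · rintro ⟨u, rfl⟩
    refine ⟨(u - s) / (t - s), ?_⟩
    have h : p + t • v - (p + s • v) = (t - s) • v := by module
    rw [h, smul_smul, div_mul_cancel₀ _ hst]
    module
  · rintro ⟨u, rfl⟩
    exact ⟨s + u * (t - s), by module⟩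

theorem IsLine.eq_of_mem {L L' : Set (ℝ × ℝ)} (hL : IsLine L) (hL' : IsLine L')
    {a b : ℝ × ℝ} (ha : a ∈ L) (hb : b ∈ L) (ha' : a ∈ L') (hb' : b ∈ L') (hab : a ≠ b) :
    L = L' :=
  (hL.eq_lineThrough ha hb hab).trans (hL'.eq_lineThrough ha' hb' hab).symm

theorem isLine_lineThrough_sub {a b : ℝ × ℝ} (hab : a ≠ b) : IsLine (lineThrough a (b - a)) :=
  ⟨a, b - a, sub_ne_zero.mpr hab.symm, rfl⟩

theorem left_mem_lineThrough (a v : ℝ × ℝ) : a ∈ lineThrough a v := ⟨0, by simp⟩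

theorem right_mem_lineThrough_sub (a b : ℝ × ℝ) : b ∈ lineThrough a (b - a) := ⟨1, by simp⟩

/-- If a line meets `M` in at most one point and `M` has fewer than `𝔠` points, then fewer than `𝔠`
points of the line lie on a secant of `M`, and any other point can be added to `M`. -/
theorem exists_insert_noThreeCollinear {B M L : Set (ℝ × ℝ)} (hL : IsLine L)
    (hBL : #↥(B ∩ L) = continuum) (hM : NoThreeCollinear M) (hcard : #M < continuum)
    (hML : (M ∩ L).Subsingleton) :
    ∃ p ∈ B ∩ L, p ∉ M ∧ NoThreeCollinear (insert p M) := by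
  let secant : M × M → Set (ℝ × ℝ) := fun x =>
    {q | x.1.1 ≠ x.2.1 ∧ q ∈ L ∧ q ∈ lineThrough x.1.1 (x.2.1 - x.1.1)}
  have hsecant (x : M × M) : #(secant x) ≤ 1 := by
    rw [Cardinal.mk_le_one_iff_set_subsingleton]
    rintro q ⟨hx, hqL, hq⟩ r ⟨-, hrL, hr⟩
    by_contra hqr
    have h := hL.eq_of_mem (isLine_lineThrough_sub hx) hqL hrL hq hr hqr
    exact hx (hML ⟨x.1.2, h ▸ left_mem_lineThrough _ _⟩
      ⟨x.2.2, h ▸ right_mem_lineThrough_sub _ _⟩)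
  have hsmall : #↥(M ∪ ⋃ x, secant x) < continuum := by
    refine (mk_union_le _ _).trans_lt (add_lt_of_lt aleph0_le_continuum hcard ?_)
    refine (mk_iUnion_le _).trans_lt ?_
    refine (mul_le_mul_right (ciSup_le' hsecant) _).trans_lt ?_
    rw [mul_one, mk_prod, lift_id]
    exact mul_lt_of_lt aleph0_le_continuum hcard hcard
  obtain ⟨p, hp, hpM⟩ : ∃ p ∈ B ∩ L, p ∉ M ∪ ⋃ x, secant x := by
    by_contra! h
    exact (mk_le_mk_of_subset h).not_gt (hBL ▸ hsmall)
  simp only [mem_union, mem_iUnion, not_or, not_exists] at hpM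
  have hpair {L'} (hL' : IsLine L') (hpL' : p ∈ L') {a b} (ha : a ∈ M) (haL : a ∈ L')
      (hb : b ∈ M) (hbL : b ∈ L') : a = b := by
    by_contra hab
    exact hpM.2 (⟨a, ha⟩, ⟨b, hb⟩) ⟨hab, hp.2, hL'.eq_lineThrough haL hbL hab ▸ hpL'⟩
  refine ⟨p, hp, hpM.1, ?_⟩
  rintro L' hL' a ⟨rfl | ha, haL⟩ b ⟨rfl | hb, hbL⟩ c ⟨rfl | hc, hcL⟩
  · exact Or.inl rfl
  · exact Or.inl rfl
  · exact Or.inr (Or.inl rfl)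
  · exact Or.inr (Or.inr (hpair hL' haL hb hbL hc hcL))
  · exact Or.inr (Or.inr rfl)
  · exact Or.inr (Or.inl (hpair hL' hbL ha haL hc hcL))
  · exact Or.inl (hpair hL' hcL ha haL hb hbL)
  · exact hM L' hL' a ⟨ha, haL⟩ b ⟨hb, hbL⟩ c ⟨hc, hcL⟩

/-- `F` is a finite part of `B` whose addition to `M` produces two points on `L` and no three
collinear points. -/
def IsExtension (B M L F : Set (ℝ × ℝ)) : Prop :=
  F.Finite ∧ F ⊆ B ∧ NoThreeCollinear (M ∪ F) ∧ ((M ∪ F) ∩ L).Nontrivial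

theorem exists_isExtension {B M L : Set (ℝ × ℝ)} (hL : IsLine L)
    (hBL : #↥(B ∩ L) = continuum) (hM : NoThreeCollinear M) (hcard : #M < continuum) :
    ∃ F, IsExtension B M L F := by
  by_cases hML : (M ∩ L).Subsingleton
  swap
  · exact ⟨∅, finite_empty, empty_subset B, by simpa using hM,
      by simpa using not_subsingleton_iff.mp hML⟩
  obtain ⟨p, hp, hpM, hMp⟩ := exists_insert_noThreeCollinear hL hBL hM hcard hML
  by_cases hML' : (insert p M ∩ L).Subsingleton
  swap
  · exact ⟨{p}, finite_singleton p, by simpa using hp.1, by simpa using hMp,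
      by simpa using not_subsingleton_iff.mp hML'⟩
  have hcard' : #↥(insert p M) < continuum :=
    mk_insert_le.trans_lt (add_lt_of_lt aleph0_le_continuum hcard
      (one_lt_aleph0.trans aleph0_lt_continuum))
  obtain ⟨q, hq, hqM, hMq⟩ := exists_insert_noThreeCollinear hL hBL hMp hcard' hML'
  refine ⟨{q, p}, by simp, ?_, by simpa [union_insert] using hMq, ?_⟩
  · rintro x (rfl | rfl)
    exacts [hq.1, hp.1]
  · exact ⟨p, ⟨by simp, hp.2⟩, q, ⟨by simp, hq.2⟩, fun h => hqM (h ▸ mem_insert p M)⟩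

theorem noThreeCollinear_iUnion {ι : Type*} {A : ι → Set (ℝ × ℝ)} (hdir : Directed (· ⊆ ·) A)
    (hA : ∀ i, NoThreeCollinear (A i)) : NoThreeCollinear (⋃ i, A i) := by
  rintro L hL a ⟨ha, haL⟩ b ⟨hb, hbL⟩ c ⟨hc, hcL⟩
  obtain ⟨i, hi⟩ := mem_iUnion.mp ha
  obtain ⟨j, hj⟩ := mem_iUnion.mp hb
  obtain ⟨k, hk⟩ := mem_iUnion.mp hc
  obtain ⟨m, him, hjm⟩ := hdir i j
  obtain ⟨n, hmn, hkn⟩ := hdir m k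
  exact hA n L hL a ⟨hmn (him hi), haL⟩ b ⟨hmn (hjm hj), hbL⟩ c ⟨hkn hk, hcL⟩

theorem monotone_iUnion_Iio_union {ι α : Type*} [LinearOrder ι] (F : ι → Set α) :
    Monotone fun i => (⋃ j : Iio i, F j) ∪ F i := by
  intro j k hjk
  rcases hjk.eq_or_lt with rfl | hlt
  · exact le_rfl
  · refine fun x hx => Or.inl ?_
    rcases hx with hx | hx
    · obtain ⟨l, hl⟩ := mem_iUnion.mp hx
      exact mem_iUnion.mpr ⟨⟨l.1, l.2.trans hlt⟩, hl⟩
    · exact mem_iUnion.mpr ⟨⟨j, hlt⟩, hx⟩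

/-- Finite sets can be added one at a time along a well-order with initial segments smaller than
`𝔠`, each extending the union of its predecessors. -/
theorem exists_isExtension_family {ι : Type} [LinearOrder ι] [WellFoundedLT ι]
    (hι : ∀ i : ι, #(Iio i) < continuum) {B : Set (ℝ × ℝ)} {L : ι → Set (ℝ × ℝ)}
    (hL : ∀ i, IsLine (L i)) (hBL : ∀ i, #↥(B ∩ L i) = continuum) :
    ∃ F : ι → Set (ℝ × ℝ), ∀ i, IsExtension B (⋃ j : Iio i, F j) (L i) (F i) := by
  let F : ι → Set (ℝ × ℝ) := wellFounded_lt.fix fun i G =>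
    Classical.epsilon fun X => IsExtension B (⋃ j : Iio i, G j.1 j.2) (L i) X
  have hF (i : ι) :
      F i = Classical.epsilon fun X => IsExtension B (⋃ j : Iio i, F j) (L i) X :=
    wellFounded_lt.fix_eq _ i
  refine ⟨F, fun i => ?_⟩
  induction i using WellFoundedLT.induction with
  | ind i ih =>
    rw [hF i]
    refine Classical.epsilon_spec (exists_isExtension (hL i) (hBL i) ?_ ?_)
    · have h : (⋃ j : Iio i, F j) = ⋃ j : Iio i, ((⋃ k : Iio j.1, F k) ∪ F j) := by
        ext x
        simp only [mem_iUnion, mem_union]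
        constructor
        · rintro ⟨j, hj⟩
          exact ⟨j, Or.inr hj⟩
        · rintro ⟨j, ⟨k, hk⟩ | hj⟩
          exacts [⟨⟨k.1, k.2.trans j.2⟩, hk⟩, ⟨j, hj⟩]
      rw [h]
      exact noThreeCollinear_iUnion
        ((monotone_iUnion_Iio_union F).comp (Subtype.mono_coe _)).directed_le
        fun j => (ih j.1 j.2).2.2.1
    · refine (mk_iUnion_le _).trans_lt ?_
      refine (mul_le_mul_right (ciSup_le' fun j : Iio i =>
        (ih j.1 j.2).1.lt_aleph0.le) _).trans_lt ?_
      exact mul_lt_of_lt aleph0_le_continuum (hι i) aleph0_lt_continuum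

/-- The lines can be enumerated along the initial ordinal of `𝔠`. -/
theorem exists_line_enumeration :
    ∃ L : continuum.{0}.ord.ToType → Set (ℝ × ℝ), (∀ i, IsLine (L i)) ∧
      ∀ K, IsLine K → ∃ i, L i = K := by
  have hle : #{K // IsLine K} ≤ #continuum.{0}.ord.ToType := by
    have hsurj : Function.Surjective fun x : {x : (ℝ × ℝ) × (ℝ × ℝ) // x.2 ≠ 0} =>
        (⟨lineThrough x.1.1 x.1.2, _, _, x.2, rfl⟩ : {K // IsLine K}) := by
      rintro ⟨K, p, v, hv, rfl⟩
      exact ⟨⟨(p, v), hv⟩, rfl⟩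
    refine (mk_le_of_surjective hsurj).trans ((mk_subtype_le _).trans ?_)
    simp [mk_real]
  obtain ⟨g⟩ := hle
  have : Nonempty {K // IsLine K} := ⟨⟨lineThrough 0 (1, 0), 0, (1, 0), by simp, rfl⟩⟩
  refine ⟨fun i => (Function.invFun g i).1, fun i => (Function.invFun g i).2, fun K hK => ?_⟩
  exact ⟨g ⟨K, hK⟩, congrArg Subtype.val (Function.leftInverse_invFun g.injective _)⟩

/-- If `B` meets every line of `ℝ²` in a set of cardinality `𝔠`,
then `B` contains a Mazurkiewicz set. -/
theorem stmt_0 (B : Set (ℝ × ℝ))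
    (hB : ∀ L : Set (ℝ × ℝ), IsLine L → #↥(B ∩ L) = Cardinal.continuum) :
    ∃ M : Set (ℝ × ℝ), IsMazurkiewicz M ∧ M ⊆ B := by
  obtain ⟨L, hL, hLsurj⟩ := exists_line_enumeration
  obtain ⟨F, hF⟩ := exists_isExtension_family
    (fun i => by simpa using mk_Iio_lt i (by simp)) hL fun i => hB _ (hL i)
  let A := fun i => (⋃ j : Iio i, F j) ∪ F i
  have hA : NoThreeCollinear (⋃ i, A i) :=
    noThreeCollinear_iUnion (monotone_iUnion_Iio_union F).directed_le fun i => (hF i).2.2.1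
  refine ⟨⋃ i, A i, fun K hK => ?_, iUnion_subset fun i => union_subset
    (iUnion_subset fun j => (hF j).2.1) (hF i).2.1⟩
  obtain ⟨i, rfl⟩ := hLsurj K hK
  obtain ⟨a, ha, b, hb, hab⟩ := (hF i).2.2.2.mono (inter_subset_inter_left _ (subset_iUnion A i))
  rw [encard_eq_two]
  refine ⟨a, b, hab, Subset.antisymm (fun c hc => ?_) (pair_subset ha hb)⟩
  rcases hA _ hK a ha b hb c hc with h | h | h
  exacts [(hab h).elim, Or.inl h.symm, Or.inr h.symm]
end
end

section
/- If X ⊆ ℝ is a basis of ℝ as a vector space over ℚ, then the set (X × {0}) ∪ ({0} × X) is a Hamel basis of ℝ² but is not a Mazurkiewicz set. -/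
open Cardinal Set

noncomputable section

/-- The union of the two coordinate copies of `X`, as images under the coordinate inclusions. -/
theorem prod_zero_union_zero_prod_eq (X : Set ℝ) :
    (X ×ˢ ({0} : Set ℝ)) ∪ (({0} : Set ℝ) ×ˢ X) =
      LinearMap.inl ℚ ℝ ℝ '' X ∪ LinearMap.inr ℚ ℝ ℝ '' X := by
  simp [Set.prod_singleton, Set.singleton_prod]

theorem isHamelBasis_prod_zero_union_zero_prod {X : Set ℝ}
    (hind : LinearIndependent ℚ ((↑) : X → ℝ)) (hspan : Submodule.span ℚ X = ⊤) :
    IsHamelBasis ((X ×ˢ ({0} : Set ℝ)) ∪ (({0} : Set ℝ) ×ˢ X)) := by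
  rw [prod_zero_union_zero_prod_eq]
  refine ⟨hind.inl_union_inr hind, ?_⟩
  rw [LinearMap.span_inl_union_inr, hspan, Submodule.prod_top]

/-- The vertical line `x = 1` meets `(X × {0}) ∪ ({0} × X)` in at most `(1, 0)`. -/
theorem not_isMazurkiewicz_prod_zero_union_zero_prod (X : Set ℝ) :
    ¬ IsMazurkiewicz ((X ×ˢ ({0} : Set ℝ)) ∪ (({0} : Set ℝ) ×ˢ X)) := by
  intro h
  have hcard := h (lineThrough (1, 0) (0, 1)) ⟨(1, 0), (0, 1), by simp, rfl⟩
  have hsub : (X ×ˢ ({0} : Set ℝ) ∪ ({0} : Set ℝ) ×ˢ X) ∩ lineThrough (1, 0) (0, 1) ⊆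
      {((1 : ℝ), (0 : ℝ))} := by
    rintro _ ⟨hX, t, rfl⟩
    simpa using And.right (by simpa using hX)
  have hle := Set.encard_le_encard hsub
  rw [hcard, Set.encard_singleton] at hle
  exact absurd hle (by norm_num)

/-- If `X` is a basis of `ℝ` over `ℚ`, then `(X × {0}) ∪ ({0} × X)` is a Hamel basis
of `ℝ²` that is not a Mazurkiewicz set. -/
theorem stmt_3 (X : Set ℝ)
    (hind : LinearIndependent ℚ ((↑) : X → ℝ))
    (hspan : Submodule.span ℚ X = ⊤) :
    IsHamelBasis ((X ×ˢ ({0} : Set ℝ)) ∪ (({0} : Set ℝ) ×ˢ X)) ∧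
      ¬ IsMazurkiewicz ((X ×ˢ ({0} : Set ℝ)) ∪ (({0} : Set ℝ) ×ˢ X)) := by
  exact ⟨isHamelBasis_prod_zero_union_zero_prod hind hspan,
    not_isMazurkiewicz_prod_zero_union_zero_prod X⟩
end
end

section
/- Suppose D ⊆ ℝ × ℝ intersects every vertical line of ℝ² in a set of cardinality 𝔠. Then there exists a Mazurkiewicz set M such that for every line ℓ of ℝ², the set Z_ℓ = {ℓ̂ | ℓ̂ is a line parallel to ℓ and M ∩ ℓ̂ ∩ ρ_ℓ(D) = ∅} has at most one element. -/
open Cardinal Set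

noncomputable section

universe u

/-- Transfinite construction of a set meeting all requirements `R i`, where `P` is preserved under
unions of chains and every small set satisfying `P` can be enlarged by finitely many points so that
it still satisfies `P` and meets a prescribed requirement. -/
theorem exists_set_of_chain_closed {X ι : Type u} {κ : Cardinal.{u}}
    (P : Set X → Prop) (R : ι → Set X → Prop)
    (hκ : ℵ₀ < κ) (hι : #ι ≤ κ)
    (hchain : ∀ c : Set (Set X), IsChain (· ⊆ ·) c → (∀ s ∈ c, P s) → P (⋃₀ c))
    (hstep : ∀ i M, P M → #M < κ → ∃ s : Set X, s.Finite ∧ P (M ∪ s) ∧ R i (M ∪ s)) :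
    ∃ M, P M ∧ ∀ i, ∃ N ⊆ M, R i N := by
  obtain ⟨_, _, hord⟩ := Cardinal.exists_ord_eq_type_lt ι
  have hF : ∀ i M, ∃ s : Set X, s.Finite ∧ (P M → #M < κ → P (M ∪ s) ∧ R i (M ∪ s)) := by
    intro i M
    by_cases h : P M ∧ #M < κ
    · obtain ⟨s, hs, h'⟩ := hstep i M h.1 h.2
      exact ⟨s, hs, fun _ _ => h'⟩
    · exact ⟨∅, Set.finite_empty, fun h₁ h₂ => absurd ⟨h₁, h₂⟩ h⟩
  choose F hFfin hF using hF
  let g : ι → Set X := (wellFounded_lt (α := ι)).fix fun i g => F i (⋃ j, ⋃ h : j < i, g j h)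
  let U : ι → Set X := fun i => ⋃ j, ⋃ _ : j < i, g j
  have hg : ∀ i, g i = F i (U i) := fun i => WellFounded.fix_eq _ _ i
  have hUcard : ∀ i, #(U i) < κ := by
    intro i
    have h₁ : #(U i) ≤ #(Iio i) * ⨆ j : Iio i, #(g j.1) :=
      Cardinal.mk_biUnion_le g (Iio i)
    have h₂ : ⨆ j : Iio i, #(g j.1) ≤ ℵ₀ := by
      refine ciSup_le' fun j => ?_
      rw [hg]
      exact (hFfin _ _).countable.le_aleph0
    have h₃ : #(Iio i) < #ι := Cardinal.mk_Iio_lt i hord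
    refine (h₁.trans (mul_le_mul_right h₂ _)).trans_lt ?_
    exact mul_lt_of_lt hκ.le (h₃.trans_le hι) hκ
  have hUmono : ∀ i j, i < j → U i ∪ g i ⊆ U j := by
    intro i j hij x hx
    simp only [U, mem_union, mem_iUnion, exists_prop] at hx ⊢
    rcases hx with ⟨k, hk, hx⟩ | hx
    · exact ⟨k, hk.trans hij, hx⟩
    · exact ⟨i, hij, hx⟩
  have hch : ∀ S : Set ι, IsChain (· ⊆ ·) ((fun i => U i ∪ g i) '' S) := by
    rintro S _ ⟨i, -, rfl⟩ _ ⟨j, -, rfl⟩ -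
    rcases lt_trichotomy i j with h | rfl | h
    · exact Or.inl ((hUmono i j h).trans subset_union_left)
    · exact Or.inl Subset.rfl
    · exact Or.inr ((hUmono j i h).trans subset_union_left)
  have key : ∀ i, P (U i ∪ g i) ∧ R i (U i ∪ g i) := by
    intro i
    induction i using WellFoundedLT.induction with
    | ind i ih =>
      have hU : U i = ⋃₀ ((fun j => U j ∪ g j) '' Iio i) := by
        apply Subset.antisymm
        · intro x hx
          simp only [U, mem_iUnion, exists_prop] at hx
          obtain ⟨j, hj, hx⟩ := hx
          exact ⟨_, ⟨j, hj, rfl⟩, Or.inr hx⟩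
        · rintro x ⟨_, ⟨j, hj, rfl⟩, hx⟩
          exact hUmono j i hj hx
      have hP : P (U i) := by
        rw [hU]
        refine hchain _ (hch _) ?_
        rintro _ ⟨j, hj, rfl⟩
        exact (ih j hj).1
      rw [hg]
      exact hF i _ hP (hUcard i)
  refine ⟨⋃₀ ((fun i => U i ∪ g i) '' univ), hchain _ (hch _) ?_, fun i =>
    ⟨U i ∪ g i, subset_sUnion_of_mem ⟨i, mem_univ i, rfl⟩, (key i).2⟩⟩
  rintro _ ⟨i, -, rfl⟩
  exact (key i).1

/-- The first coordinate of `p` after rotating by `-θ`; its level sets are the images of the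
vertical lines under `rot θ`. -/
def offset (θ : ℝ) (p : ℝ × ℝ) : ℝ := p.1 * Real.cos θ + p.2 * Real.sin θ

theorem offset_rot (θ : ℝ) (p : ℝ × ℝ) : offset θ (rot θ p) = p.1 := by
  simp only [offset, rot]
  linear_combination p.1 * Real.sin_sq_add_cos_sq θ

theorem rot_injective (θ : ℝ) : Function.Injective (rot θ) := by
  intro p q h
  have h₁ := congrArg (offset θ) h
  simp only [offset_rot] at h₁
  simp only [rot, Prod.mk.injEq] at h
  refine Prod.ext h₁ ?_
  linear_combination Real.cos θ * h.2 - Real.sin θ * h.1 -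
    (p.2 - q.2) * Real.sin_sq_add_cos_sq θ

theorem offset_add_smul (θ : ℝ) (p v : ℝ × ℝ) (t : ℝ) :
    offset θ (p + t • v) = offset θ p + t * offset θ v := by
  simp only [offset, Prod.fst_add, Prod.snd_add, Prod.smul_fst, Prod.smul_snd, smul_eq_mul]
  ring

theorem offset_smul (θ : ℝ) (v : ℝ × ℝ) (t : ℝ) : offset θ (t • v) = t * offset θ v := by
  simp only [offset, Prod.smul_fst, Prod.smul_snd, smul_eq_mul]
  ring

/-- Two distinct points lie on a common level line of `offset θ` for at most one `θ ∈ [0, π)`. -/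
theorem angle_unique {a b : ℝ × ℝ} (hab : a ≠ b) {θ θ' : ℝ} (hθ : θ ∈ Ico 0 Real.pi)
    (hθ' : θ' ∈ Ico 0 Real.pi) (h : offset θ a = offset θ b) (h' : offset θ' a = offset θ' b) :
    θ = θ' := by
  have hsin : Real.sin (θ - θ') = 0 := by
    by_contra hne
    apply hab
    simp only [offset] at h h'
    rw [Real.sin_sub] at hne
    refine Prod.ext (mul_right_cancel₀ hne ?_) (mul_right_cancel₀ hne ?_)
    · linear_combination Real.sin θ * h' - Real.sin θ' * h
    · linear_combination Real.cos θ' * h - Real.cos θ * h'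
  have := (Real.sin_eq_zero_iff_of_lt_of_lt (by linarith [hθ.1, hθ'.2])
    (by linarith [hθ.2, hθ'.1])).1 hsin
  linarith

theorem lineThrough_eq_offset {θ : ℝ} {p v : ℝ × ℝ} (hv : v ≠ 0) (h : offset θ v = 0) :
    lineThrough p v = {q | offset θ q = offset θ p} := by
  ext q
  constructor
  · rintro ⟨t, rfl⟩
    simp [offset_add_smul, h]
  · intro hq
    have hsc := Real.sin_sq_add_cos_sq θ
    simp only [offset, mem_ofPred_eq] at h hq
    set c := v.2 * Real.cos θ - v.1 * Real.sin θ with hc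
    have h₁ : v.1 = -c * Real.sin θ := by
      linear_combination Real.cos θ * h - v.1 * hsc
    have h₂ : v.2 = c * Real.cos θ := by
      linear_combination Real.sin θ * h - v.2 * hsc
    have hc0 : c ≠ 0 := by
      intro h0
      apply hv
      ext
      · simp [h₁, h0]
      · simp [h₂, h0]
    refine ⟨((q.2 - p.2) * Real.cos θ - (q.1 - p.1) * Real.sin θ) / c, ?_⟩
    ext
    · simp only [Prod.fst_add, Prod.smul_fst, smul_eq_mul]
      rw [h₁]
      field_simp
      linear_combination Real.cos θ * hq - (q.1 - p.1) * hsc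
    · simp only [Prod.snd_add, Prod.smul_snd, smul_eq_mul]
      rw [h₂]
      field_simp
      linear_combination Real.sin θ * hq - (q.2 - p.2) * hsc

theorem exists_angle (v : ℝ × ℝ) : ∃ θ ∈ Ico 0 Real.pi, offset θ v = 0 := by
  have hcont : ContinuousOn (fun θ => offset θ v) (uIcc 0 Real.pi) := by
    unfold offset
    fun_prop
  have hmem : (0 : ℝ) ∈ uIcc (offset 0 v) (offset Real.pi v) := by
    rw [mem_uIcc]
    simp only [offset, Real.cos_zero, Real.sin_zero, Real.cos_pi, Real.sin_pi]
    rcases le_total v.1 0 with h | h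
    · left; constructor <;> linarith
    · right; constructor <;> linarith
  obtain ⟨θ, hθ, h⟩ := intermediate_value_uIcc hcont hmem
  rw [uIcc_of_le Real.pi_pos.le] at hθ
  rcases hθ.2.lt_or_eq with hlt | rfl
  · exact ⟨θ, ⟨hθ.1, hlt⟩, h⟩
  · refine ⟨0, ⟨le_rfl, Real.pi_pos⟩, ?_⟩
    simp only [offset, Real.cos_zero, Real.sin_zero, Real.cos_pi, Real.sin_pi] at h ⊢
    linarith

theorem offset_eq_zero_of_lineThrough_subset {θ s : ℝ} {p v : ℝ × ℝ}
    (h : lineThrough p v ⊆ {q | offset θ q = s}) : offset θ v = 0 := by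
  have h₀ : offset θ p = s := h ⟨0, by simp⟩
  have h₁ : offset θ (p + (1 : ℝ) • v) = s := h ⟨1, rfl⟩
  rw [offset_add_smul] at h₁
  linarith

/-- Parallel lines are level lines of the same `offset θ`. -/
theorem ParallelLines.exists_eq_offset {θ s : ℝ} {L₁ L₂ : Set (ℝ × ℝ)} (h : ParallelLines L₁ L₂)
    (h₂ : L₂ = {q | offset θ q = s}) : ∃ s', L₁ = {q | offset θ q = s'} := by
  obtain ⟨p₁, p₂, v, c, hv, hc, rfl, hL⟩ := h
  have h0 : offset θ (c • v) = 0 := offset_eq_zero_of_lineThrough_subset (hL.symm.trans h₂).subset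
  rw [offset_smul, mul_eq_zero, or_iff_right hc] at h0
  exact ⟨_, lineThrough_eq_offset hv h0⟩

/-- A partial Mazurkiewicz set: no three points are collinear, and among any two distinct parallel
lines spanned by points of `M`, one meets `M` in a point of the corresponding rotation of `D`. -/
structure IsPartial (D M : Set (ℝ × ℝ)) : Prop where
  not_collinear : ∀ θ ∈ Ico 0 Real.pi, ∀ a ∈ M, ∀ b ∈ M, ∀ c ∈ M, a ≠ b → a ≠ c → b ≠ c →
    offset θ a = offset θ b → offset θ a ≠ offset θ c
  good : ∀ θ ∈ Ico 0 Real.pi, ∀ a ∈ M, ∀ b ∈ M, ∀ c ∈ M, ∀ d ∈ M, a ≠ b → c ≠ d →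
    offset θ a = offset θ b → offset θ c = offset θ d → offset θ a ≠ offset θ c →
    a ∈ rot θ '' D ∨ b ∈ rot θ '' D ∨ c ∈ rot θ '' D ∨ d ∈ rot θ '' D

theorem IsPartial.sUnion {D : Set (ℝ × ℝ)} {C : Set (Set (ℝ × ℝ))} (hC : IsChain (· ⊆ ·) C)
    (h : ∀ M ∈ C, IsPartial D M) : IsPartial D (⋃₀ C) := by
  have key : ∀ a ∈ ⋃₀ C, ∀ b ∈ ⋃₀ C, ∀ c ∈ ⋃₀ C, ∀ d ∈ ⋃₀ C,
      ∃ M ∈ C, a ∈ M ∧ b ∈ M ∧ c ∈ M ∧ d ∈ M := by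
    intro a ha b hb c hc d hd
    obtain ⟨M, hM, hsub⟩ := hC.directedOn.exists_mem_subset_of_finite_of_subset_sUnion
      (s := {a, b, c, d}) (by obtain ⟨M, hM, -⟩ := ha; exact ⟨M, hM⟩) (by simp)
      (by rintro x (rfl | rfl | rfl | rfl) <;> assumption)
    exact ⟨M, hM, hsub (by simp), hsub (by simp), hsub (by simp), hsub (by simp)⟩
  constructor
  · intro θ hθ a ha b hb c hc
    obtain ⟨M, hM, ha, hb, hc, -⟩ := key a ha b hb c hc c hc
    exact (h M hM).not_collinear θ hθ a ha b hb c hc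
  · intro θ hθ a ha b hb c hc d hd
    obtain ⟨M, hM, ha, hb, hc, hd⟩ := key a ha b hb c hc d hd
    exact (h M hM).good θ hθ a ha b hb c hc d hd

/-- A point of `rot θ '' D` can be added on a level line on which `M` has at most one point, as long
as it avoids the lines through other points of `M` that are parallel to lines spanned by `M`. -/
theorem IsPartial.insert_point {D M : Set (ℝ × ℝ)} (hM : IsPartial D M) {θ : ℝ} (hθ : θ ∈ Ico 0 Real.pi)
    {p : ℝ × ℝ} (hp : p ∈ rot θ '' D)
    (hsub : (M ∩ {q | offset θ q = offset θ p}).Subsingleton)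
    (havoid : ∀ q ∈ M, ∀ c ∈ M, ∀ d ∈ M, offset θ q ≠ offset θ p → c ≠ d →
      ∀ θ' ∈ Ico 0 Real.pi, offset θ' c = offset θ' d → offset θ' p ≠ offset θ' q) :
    IsPartial D (insert p M) := by
  have hcol : ∀ θ' ∈ Ico 0 Real.pi, ∀ a ∈ M, ∀ b ∈ M, a ≠ b → offset θ' a = offset θ' b →
      offset θ' p ≠ offset θ' a := by
    intro θ' hθ' a ha b hb hab h hpa
    by_cases hqa : offset θ a = offset θ p
    · by_cases hqb : offset θ b = offset θ p
      · exact hab (hsub ⟨ha, hqa⟩ ⟨hb, hqb⟩)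
      · exact havoid b hb a ha b hb hqb hab θ' hθ' h (hpa.trans h)
    · exact havoid a ha a ha b hb hqa hab θ' hθ' h hpa
  have hgood : ∀ θ' ∈ Ico 0 Real.pi, ∀ b ∈ M, ∀ c ∈ M, ∀ d ∈ M, p ≠ b → c ≠ d →
      offset θ' p = offset θ' b → offset θ' c = offset θ' d → p ∈ rot θ' '' D := by
    intro θ' hθ' b hb c hc d hd hpb hcd h h'
    by_cases hqb : offset θ b = offset θ p
    · rwa [← angle_unique hpb hθ hθ' hqb.symm h]
    · exact absurd h (havoid b hb c hc d hd hqb hcd θ' hθ' h')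
  constructor
  · intro θ' hθ' a ha b hb c hc hab hac hbc h h'
    rcases ha with rfl | ha <;> rcases hb with rfl | hb <;> rcases hc with rfl | hc
    · exact hab rfl
    · exact hab rfl
    · exact hac rfl
    · exact hcol θ' hθ' b hb c hc hbc (h.symm.trans h') h
    · exact hbc rfl
    · exact hcol θ' hθ' a ha c hc hac h' h.symm
    · exact hcol θ' hθ' a ha b hb hab h h'.symm
    · exact hM.not_collinear θ' hθ' a ha b hb c hc hab hac hbc h h'
  · intro θ' hθ' a ha b hb c hc d hd hab hcd h h' hne
    by_cases hap : a = p
    · subst hap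
      have hb := hb.resolve_left hab.symm
      have hc := hc.resolve_left fun e => hne (by rw [e])
      have hd := hd.resolve_left fun e => hne (by rw [h', e])
      exact Or.inl (hgood θ' hθ' b hb c hc d hd hab hcd h h')
    by_cases hbp : b = p
    · subst hbp
      have ha := ha.resolve_left hab
      have hc := hc.resolve_left fun e => hne (by rw [h, e])
      have hd := hd.resolve_left fun e => hne (by rw [h, h', e])
      exact Or.inr (Or.inl (hgood θ' hθ' a ha c hc d hd hab.symm hcd h.symm h'))
    replace ha := ha.resolve_left hap
    replace hb := hb.resolve_left hbp
    by_cases hcp : c = p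
    · subst hcp
      have hd := hd.resolve_left hcd.symm
      exact Or.inr (Or.inr (Or.inl (hgood θ' hθ' d hd a ha b hb hcd hab h' h)))
    by_cases hdp : d = p
    · subst hdp
      have hc := hc.resolve_left hcd
      exact Or.inr (Or.inr (Or.inr (hgood θ' hθ' c hc a ha b hb hcd.symm hab h'.symm h)))
    exact hM.good θ' hθ' a ha b hb c (hc.resolve_left hcp) d (hd.resolve_left hdp) hab hcd h h' hne

theorem continuum_le_mk_offset_inter {D : Set (ℝ × ℝ)}
    (hD : ∀ L : Set (ℝ × ℝ), IsVerticalLine L → #↥(D ∩ L) = Cardinal.continuum) (θ s : ℝ) :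
    Cardinal.continuum ≤ #↥({q | offset θ q = s} ∩ rot θ '' D) := by
  rw [← hD _ ⟨s, rfl⟩, ← Cardinal.mk_image_eq (rot_injective θ)]
  apply Cardinal.mk_le_mk_of_subset
  rintro _ ⟨p, ⟨hpD, hp⟩, rfl⟩
  exact ⟨(offset_rot θ p).trans hp, p, hpD, rfl⟩

theorem IsPartial.exists_insert {D M : Set (ℝ × ℝ)}
    (hD : ∀ L : Set (ℝ × ℝ), IsVerticalLine L → #↥(D ∩ L) = Cardinal.continuum)
    (hM : IsPartial D M) (hcard : #M < Cardinal.continuum) {θ : ℝ} (hθ : θ ∈ Ico 0 Real.pi)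
    {s : ℝ} (hsub : (M ∩ {q | offset θ q = s}).Subsingleton) :
    ∃ p ∉ M, offset θ p = s ∧ IsPartial D (insert p M) := by
  let B : M × M × M → Set (ℝ × ℝ) := fun t =>
    {p | offset θ p = s ∧ offset θ t.1.1 ≠ s ∧ t.2.1 ≠ t.2.2 ∧ ∃ θ' ∈ Ico 0 Real.pi,
      offset θ' t.2.1.1 = offset θ' t.2.2.1 ∧ offset θ' p = offset θ' t.1.1}
  have hB : ∀ t, #(B t) ≤ 1 := by
    rintro ⟨q, c, d⟩
    rw [Cardinal.mk_le_one_iff_set_subsingleton]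
    rintro p₁ ⟨h₁, hq, hcd, θ₁, hθ₁, e₁, f₁⟩ p₂ ⟨h₂, -, -, θ₂, hθ₂, e₂, f₂⟩
    by_contra hne
    obtain rfl := angle_unique (fun h => hcd (Subtype.ext h)) hθ₁ hθ₂ e₁ e₂
    obtain rfl := angle_unique hne hθ hθ₁ (h₁.trans h₂.symm) (f₁.trans f₂.symm)
    exact hq (f₁.symm.trans h₁)
  have hunion : #↥(⋃ t, B t) < Cardinal.continuum := by
    refine (Cardinal.mk_iUnion_le B).trans_lt ?_
    refine mul_lt_of_lt aleph0_le_continuum ?_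
      ((ciSup_le' hB).trans_lt (one_lt_aleph0.trans aleph0_lt_continuum))
    rw [mk_prod, mk_prod]
    simp only [lift_id]
    exact mul_lt_of_lt aleph0_le_continuum hcard (mul_lt_of_lt aleph0_le_continuum hcard hcard)
  have hbad : #↥(M ∪ ⋃ t, B t) < Cardinal.continuum :=
    (mk_union_le _ _).trans_lt (add_lt_of_lt aleph0_le_continuum hcard hunion)
  obtain ⟨p, ⟨hps, hpD⟩, hpbad⟩ := Set.not_subset.1 fun h =>
    (((continuum_le_mk_offset_inter hD θ s).trans (mk_le_mk_of_subset h)).trans_lt hbad).false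
  rw [mem_union, not_or] at hpbad
  refine ⟨p, hpbad.1, hps, hM.insert_point hθ hpD (by rwa [hps]) ?_⟩
  intro q hq c hc d hd hqs hcd θ' hθ' e f
  exact hpbad.2 (mem_iUnion.2 ⟨(⟨q, hq⟩, ⟨c, hc⟩, ⟨d, hd⟩), hps, fun h => hqs (h.trans hps.symm),
    fun h => hcd (congrArg Subtype.val h), θ', hθ', e, f⟩)

theorem IsPartial.exists_union {D M : Set (ℝ × ℝ)}
    (hD : ∀ L : Set (ℝ × ℝ), IsVerticalLine L → #↥(D ∩ L) = Cardinal.continuum)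
    (hM : IsPartial D M) (hcard : #M < Cardinal.continuum) {θ : ℝ} (hθ : θ ∈ Ico 0 Real.pi)
    (s : ℝ) : ∃ S : Set (ℝ × ℝ), S.Finite ∧ IsPartial D (M ∪ S) ∧
      ((M ∪ S) ∩ {q | offset θ q = s}).Nontrivial := by
  by_cases h₀ : (M ∩ {q | offset θ q = s}).Subsingleton
  · obtain ⟨p, hpM, hps, hP⟩ := hM.exists_insert hD hcard hθ h₀
    by_cases h₁ : (insert p M ∩ {q | offset θ q = s}).Subsingleton
    · have hcard' : #↥(insert p M) < Cardinal.continuum :=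
        mk_insert_le.trans_lt (add_lt_of_lt aleph0_le_continuum hcard
          (one_lt_aleph0.trans aleph0_lt_continuum))
      obtain ⟨p', hpM', hps', hP'⟩ := IsPartial.exists_insert hD hP hcard' hθ h₁
      refine ⟨{p', p}, by simp, ?_, p', ⟨by simp, hps'⟩, p, ⟨by simp, hps⟩, ?_⟩
      · rwa [union_insert, union_singleton]
      · rintro rfl
        exact hpM' (mem_insert _ _)
    · refine ⟨{p}, by simp, ?_, ?_⟩
      · rwa [union_singleton]
      · rw [union_singleton]
        exact not_subsingleton_iff.1 h₁
  · exact ⟨∅, finite_empty, by rwa [union_empty], by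
      rw [union_empty]; exact not_subsingleton_iff.1 h₀⟩

/-- If `D` meets every vertical line in a set of cardinality `𝔠`, there is a
Mazurkiewicz set `M` such that for every line `ℓ`, at most one line parallel to `ℓ`
misses `M ∩ ρ_ℓ(D)`, where `ρ_ℓ` is the rotation by the unique `θ_ℓ ∈ [0, π)`
mapping vertical lines to lines parallel to `ℓ`. -/
theorem stmt_5 (D : Set (ℝ × ℝ))
    (hD : ∀ L : Set (ℝ × ℝ), IsVerticalLine L → #↥(D ∩ L) = Cardinal.continuum) :
    ∃ M : Set (ℝ × ℝ), IsMazurkiewicz M ∧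
      ∀ L : Set (ℝ × ℝ), IsLine L →
        ∀ θ ∈ Set.Ico (0 : ℝ) Real.pi,
          (∀ V : Set (ℝ × ℝ), IsVerticalLine V → ParallelLines (rot θ '' V) L) →
            {L' : Set (ℝ × ℝ) | IsLine L' ∧ ParallelLines L' L ∧
              M ∩ L' ∩ (rot θ '' D) = ∅}.Subsingleton := by
  obtain ⟨M, hM, hMR⟩ := exists_set_of_chain_closed (ι := Ico 0 Real.pi × ℝ)
    (κ := Cardinal.continuum) (IsPartial D)
    (fun i N => (N ∩ {q | offset i.1 q = i.2}).Nontrivial) aleph0_lt_continuum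
    (by
      simp only [mk_prod, lift_id, mk_real]
      exact (mul_le_mul_left ((mk_set_le _).trans_eq mk_real) _).trans_eq continuum_mul_self)
    (fun _ => IsPartial.sUnion)
    (fun i N hN hcard => hN.exists_union hD hcard i.1.2 i.2)
  have htwo : ∀ θ ∈ Ico 0 Real.pi, ∀ s, (M ∩ {q | offset θ q = s}).Nontrivial := by
    intro θ hθ s
    obtain ⟨N, hNM, hN⟩ := hMR (⟨θ, hθ⟩, s)
    exact hN.mono (inter_subset_inter_left _ hNM)
  refine ⟨M, ?_, ?_⟩
  · rintro _ ⟨p, v, hv, rfl⟩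
    obtain ⟨θ, hθ, h⟩ := exists_angle v
    rw [lineThrough_eq_offset hv h]
    obtain ⟨a, ha, b, hb, hab⟩ := htwo θ hθ (offset θ p)
    rw [← encard_pair hab]
    congr 1
    refine Subset.antisymm (fun c hc => ?_) (pair_subset ha hb)
    by_contra hne
    simp only [mem_insert_iff, mem_singleton_iff, not_or] at hne
    exact hM.not_collinear θ hθ a ha.1 b hb.1 c hc.1 hab (Ne.symm hne.1) (Ne.symm hne.2)
      (ha.2.trans hb.2.symm) (ha.2.trans hc.2.symm)
  · intro L hL θ hθ hpar
    have hV : rot θ '' {p : ℝ × ℝ | p.1 = 0} ⊆ {q | offset θ q = 0} := by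
      rintro _ ⟨p, hp, rfl⟩
      exact (offset_rot θ p).trans hp
    obtain ⟨s, hs⟩ : ∃ s, L = {q | offset θ q = s} := by
      obtain ⟨p₁, p₂, v, c, hv, hc, h₁, rfl⟩ := hpar _ ⟨0, rfl⟩
      have h0 := offset_eq_zero_of_lineThrough_subset (h₁.symm.subset.trans hV)
      refine ⟨_, lineThrough_eq_offset (smul_ne_zero hc hv) ?_⟩
      rw [offset_smul, h0, mul_zero]
    rintro L₁ ⟨-, hL₁, hempty₁⟩ L₂ ⟨-, hL₂, hempty₂⟩
    obtain ⟨s₁, rfl⟩ := hL₁.exists_eq_offset hs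
    obtain ⟨s₂, rfl⟩ := hL₂.exists_eq_offset hs
    by_contra hne
    obtain ⟨a, ha, b, hb, hab⟩ := htwo θ hθ s₁
    obtain ⟨c, hc, d, hd, hcd⟩ := htwo θ hθ s₂
    have hs₁₂ : offset θ a ≠ offset θ c := fun h => hne (by
      rw [← show offset θ a = s₁ from ha.2, ← show offset θ c = s₂ from hc.2, h])
    rw [eq_empty_iff_forall_notMem] at hempty₁ hempty₂
    rcases hM.good θ hθ a ha.1 b hb.1 c hc.1 d hd.1 hab hcd (ha.2.trans hb.2.symm)
      (hc.2.trans hd.2.symm) hs₁₂ with h | h | h | h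
    · exact hempty₁ a ⟨ha, h⟩
    · exact hempty₁ b ⟨hb, h⟩
    · exact hempty₂ c ⟨hc, h⟩
    · exact hempty₂ d ⟨hd, h⟩
end
end

section
/- Every Mazurkiewicz set is a union of two bijections on ℝ: for every Mazurkiewicz set M ⊆ ℝ × ℝ there exist bijections f g : ℝ → ℝ whose graphs are disjoint and satisfy M = {(x, f x) | x ∈ ℝ} ∪ {(x, g x) | x ∈ ℝ}. -/
open Cardinal Set

noncomputable section

/-- A relation in which every element has exactly two relatives on the other side satisfies
Hall's condition, so it contains the graph of an injective function. -/
theorem exists_injective_of_encard_eq_two {α β : Type*} {R : α → β → Prop}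
    (hα : ∀ a, {b | R a b}.encard = 2) (hβ : ∀ b, {a | R a b}.encard = 2) :
    ∃ f : α → β, Function.Injective f ∧ ∀ a, R a (f a) := by
  classical
  have hfin : ∀ a, {b | R a b}.Finite := fun a => Set.finite_of_encard_eq_coe (hα a)
  have hcard : ∀ a, (hfin a).toFinset.card = 2 := fun a => by
    have h := hα a
    rw [(hfin a).encard_eq_coe_toFinset_card] at h
    exact_mod_cast h
  obtain ⟨f, hf, hR⟩ := (Finset.all_card_le_biUnion_card_iff_exists_injective
    fun a => (hfin a).toFinset).1 fun s => by
      have key := Finset.card_mul_le_card_mul (s := s)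
        (t := s.biUnion fun a => (hfin a).toFinset) R (m := 2) (n := 2) ?_ ?_
      · omega
      · intro a ha
        rw [← hcard a]
        refine Finset.card_le_card fun b hb => ?_
        exact (Finset.mem_bipartiteAbove R).2
          ⟨Finset.mem_biUnion.2 ⟨a, ha, hb⟩, (hfin a).mem_toFinset.1 hb⟩
      · intro b _
        have h := hβ b
        have hle : ((s.bipartiteBelow R b : Finset α) : Set α).encard ≤ 2 := by
          rw [← h]
          exact Set.encard_le_encard fun a ha =>
            ((Finset.mem_bipartiteBelow R).1 (Finset.mem_coe.1 ha)).2
        rw [Set.encard_coe_eq_coe_finsetCard] at hle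
        exact_mod_cast hle
  exact ⟨f, hf, fun a => (hfin a).mem_toFinset.1 (hR a)⟩

/-- A relation in which every element has exactly two relatives on the other side is the disjoint
union of the graphs of two bijections. -/
theorem exists_bijective_pair_of_encard_eq_two {α β : Type*} {R : α → β → Prop}
    (hα : ∀ a, {b | R a b}.encard = 2) (hβ : ∀ b, {a | R a b}.encard = 2) :
    ∃ f g : α → β, Function.Bijective f ∧ Function.Bijective g ∧ (∀ a, f a ≠ g a) ∧
      ∀ a b, R a b ↔ b = f a ∨ b = g a := by
  obtain ⟨i, hi, hRi⟩ := exists_injective_of_encard_eq_two hα hβ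
  obtain ⟨j, hj, hRj⟩ := exists_injective_of_encard_eq_two (R := fun b a => R a b) hβ hα
  obtain ⟨f, hf, hRf⟩ := Function.Embedding.schroeder_bernstein_of_rel hi hj R hRi hRj
  have hother : ∀ a, ∃ c, f a ≠ c ∧ ∀ b, R a b ↔ b = f a ∨ b = c := fun a => by
    obtain ⟨x, y, hxy, hset⟩ := Set.encard_eq_two.1 (hα a)
    have hiff : ∀ b, R a b ↔ b = x ∨ b = y := fun b => Set.ext_iff.1 hset b
    rcases (hiff _).1 (hRf a) with h | h
    · exact ⟨y, h ▸ hxy, fun b => by rw [hiff, h]⟩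
    · exact ⟨x, h ▸ hxy.symm, fun b => by rw [hiff, h, or_comm]⟩
  choose g hfg hR using hother
  refine ⟨f, g, hf, ⟨fun a a' haa' => ?_, fun b => ?_⟩, hfg, hR⟩
  · obtain ⟨c, hc⟩ := hf.2 (g a)
    obtain ⟨x, y, hxy, hset⟩ := Set.encard_eq_two.1 (hβ (g a))
    have hiff : ∀ a', R a' (g a) ↔ a' = x ∨ a' = y := fun a' => Set.ext_iff.1 hset a'
    have hca : c ≠ a := fun h => hfg a (h ▸ hc)
    have hca' : c ≠ a' := fun h => hfg a' (by rw [← haa', ← hc, h])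
    have h₁ := (hiff c).1 ((hR c _).2 (Or.inl hc.symm))
    have h₂ := (hiff a).1 ((hR a _).2 (Or.inr rfl))
    have h₃ := (hiff a').1 ((hR a' _).2 (Or.inr haa'))
    grind
  · obtain ⟨x, y, hxy, hset⟩ := Set.encard_eq_two.1 (hβ b)
    have hiff : ∀ a, R a b ↔ a = x ∨ a = y := fun a => Set.ext_iff.1 hset a
    rcases (hR x b).1 ((hiff x).2 (Or.inl rfl)) with hx | hx
    · rcases (hR y b).1 ((hiff y).2 (Or.inr rfl)) with hy | hy
      · exact absurd (hf.1 (hx.symm.trans hy)) hxy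
      · exact ⟨y, hy.symm⟩
    · exact ⟨x, hx.symm⟩

theorem IsMazurkiewicz.encard_vertical {M : Set (ℝ × ℝ)} (hM : IsMazurkiewicz M) (x : ℝ) :
    {y | (x, y) ∈ M}.encard = 2 := by
  rw [← hM _ ⟨(x, 0), (0, 1), by simp, rfl⟩, ← (Prod.mk_right_injective x).encard_image]
  congr 1
  ext ⟨a, b⟩
  simp [lineThrough]
  grind

theorem IsMazurkiewicz.encard_horizontal {M : Set (ℝ × ℝ)} (hM : IsMazurkiewicz M) (y : ℝ) :
    {x | (x, y) ∈ M}.encard = 2 := by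
  rw [← hM _ ⟨(0, y), (1, 0), by simp, rfl⟩, ← (Prod.mk_left_injective y).encard_image]
  congr 1
  ext ⟨a, b⟩
  simp [lineThrough]
  grind

/-- Every Mazurkiewicz set is a union of two bijections on `ℝ` with disjoint graphs. -/
theorem stmt_9 (M : Set (ℝ × ℝ)) (hM : IsMazurkiewicz M) :
    ∃ f g : ℝ → ℝ, Function.Bijective f ∧ Function.Bijective g ∧
      (∀ x : ℝ, f x ≠ g x) ∧ M = graphOf f ∪ graphOf g := by
  obtain ⟨f, g, hf, hg, hfg, hR⟩ := exists_bijective_pair_of_encard_eq_two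
    (R := fun x y => (x, y) ∈ M) hM.encard_vertical hM.encard_horizontal
  refine ⟨f, g, hf, hg, hfg, ?_⟩
  ext ⟨x, y⟩
  simp [graphOf, hR]
end
end
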